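/- Let W ∈ ℤ^{m×n} have rows whose positive hull is ℝ^n (so every P_u = {y ∈ ℝ^n : Wy ≤ u} is a polytope), let 𝒰(W) = {u ∈ ℝ^m : P_u ≠ ∅}, and let 𝒞 be a set of vectors in ℝ^n (not necessarily finite). Then there is a finite generating set for the family of truncated polytopes: there exist finitely many h¹,…,h^k ∈ 𝒰(W) ∩ ℤ^m such that every z ∈ 𝒰(W) ∩ ℤ^m admits nonnegative integers λ₁,…,λ_k with z = Σ_j λ_j hʲ and tr_𝒞(P_z) ⊆ Σ_j λ_j tr_𝒞(P_{hʲ}) (Minkowski sum). -/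

import Mathlib

open Pointwise

/-- The polytope `P_u = {y ∈ ℝ^n : Wy ≤ u}` for an integral matrix `W` and an integral
right-hand side `u`. -/
def polyOf {ι : Type*} [Fintype ι] {n : ℕ} (W : Matrix ι (Fin n) ℤ) (u : ι → ℤ) :
    Set (Fin n → ℝ) :=
  {y | ∀ i, ∑ j, (W i j : ℝ) * y j ≤ (u i : ℝ)}

/-- `u` reduces `v`, written `u ⊑ v`: componentwise `u⁽ⁱ⁾v⁽ⁱ⁾ ≥ 0` and `|u⁽ⁱ⁾| ≤ |v⁽ⁱ⁾|`. -/
def Reduces {ι : Type*} (u v : ι → ℝ) : Prop :=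
  ∀ i, 0 ≤ u i * v i ∧ |u i| ≤ |v i|

/-- The truncation `tr_𝒞(S)` with respect to a set of vectors `𝒞`. -/
def trunc {ι : Type*} (C : Set (ι → ℝ)) (S : Set (ι → ℝ)) : Set (ι → ℝ) :=
  {y ∈ S | ¬ ∃ c ∈ C, Reduces c y}

/-- `minkSMul m S` is the `m`-fold Minkowski sum of the set `S` with itself,
with the convention `minkSMul 0 S = {0}`. -/
def minkSMul {α : Type*} [AddMonoid α] : ℕ → Set α → Set α
  | 0, _ => {0}
  | m + 1, S => S + minkSMul m S

theorem mem_polyOf_iff {ι : Type*} [Fintype ι] {n : ℕ} {W : Matrix ι (Fin n) ℤ} {u : ι → ℤ}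
    {y : Fin n → ℝ} : y ∈ polyOf W u ↔ ∀ i, (W.map (Int.cast : ℤ → ℝ)).mulVec y i ≤ u i :=
  Iff.rfl

theorem isClosed_polyOf {ι : Type*} [Fintype ι] {n : ℕ} (W : Matrix ι (Fin n) ℤ) (u : ι → ℤ) :
    IsClosed (polyOf W u) := by
  simp only [polyOf, Set.ofPred_forall]
  exact isClosed_iInter fun i => isClosed_le (by fun_prop) continuous_const

theorem convex_polyOf {ι : Type*} [Fintype ι] {n : ℕ} (W : Matrix ι (Fin n) ℤ) (u : ι → ℤ) :
    Convex ℝ (polyOf W u) := by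
  intro x hx y hy a b ha hb hab i
  have h1 := mul_le_mul_of_nonneg_left (hx i) ha
  have h2 := mul_le_mul_of_nonneg_left (hy i) hb
  have h3 : ∑ j, (W i j : ℝ) * (a • x + b • y) j =
      a * ∑ j, (W i j : ℝ) * x j + b * ∑ j, (W i j : ℝ) * y j := by
    simp only [Finset.mul_sum, ← Finset.sum_add_distrib, Pi.add_apply, Pi.smul_apply, smul_eq_mul]
    exact Finset.sum_congr rfl fun j _ => by ring
  have h4 : (u i : ℝ) = a * u i + b * u i := by rw [← add_mul, hab, one_mul]
  rw [h3, h4]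
  exact add_le_add h1 h2

/-- If the rows of `W` positively span the space, then every `polyOf W u` is compact. -/
theorem isCompact_polyOf {ι : Type*} [Fintype ι] {n : ℕ} (W : Matrix ι (Fin n) ℤ)
    (hpos : ∀ x : Fin n → ℝ, ∃ μ : ι → ℝ, (∀ i, 0 ≤ μ i) ∧
      x = ∑ i, μ i • (fun j => (W i j : ℝ))) (u : ι → ℤ) :
    IsCompact (polyOf W u) := by
  have bound : ∀ x : Fin n → ℝ, ∃ c : ℝ, ∀ y ∈ polyOf W u, ∑ j, x j * y j ≤ c := by
    intro x
    obtain ⟨μ, hμ, rfl⟩ := hpos x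
    refine ⟨∑ i, μ i * u i, fun y hy => ?_⟩
    calc ∑ j, (∑ i, μ i • (fun j => (W i j : ℝ))) j * y j
        = ∑ i, μ i * ∑ j, (W i j : ℝ) * y j := by
          simp only [Finset.sum_apply, Pi.smul_apply, smul_eq_mul, Finset.sum_mul, Finset.mul_sum]
          rw [Finset.sum_comm]
          simp only [mul_assoc]
      _ ≤ _ := Finset.sum_le_sum fun i _ => mul_le_mul_of_nonneg_left (hy i) (hμ i)
  choose c hc using bound
  refine (isCompact_Icc (a := fun j => -c (-Pi.single j 1))
    (b := fun j => c (Pi.single j 1))).of_isClosed_subset (isClosed_polyOf W u) fun y hy => ?_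
  refine ⟨fun j => ?_, fun j => ?_⟩
  · have := hc (-Pi.single j 1) y hy
    simp only [Pi.neg_apply, Pi.single_apply, neg_mul, ite_mul, one_mul, zero_mul,
      Finset.sum_neg_distrib, Finset.sum_ite_eq', Finset.mem_univ, if_true] at this
    simp only
    linarith
  · have := hc (Pi.single j 1) y hy
    simpa [Pi.single_apply] using this

/-- At an extreme point, the tight constraints determine the point. -/
theorem eq_zero_of_mulVec_tight_eq_zero {κ : Type*} [Fintype κ] {n : ℕ}
    {A : Matrix κ (Fin n) ℤ} {b : κ → ℤ} {y : Fin n → ℝ}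
    (hy : y ∈ (polyOf A b).extremePoints ℝ) {v : Fin n → ℝ}
    (hv : ∀ i, (A.map (Int.cast : ℤ → ℝ)).mulVec y i = b i →
      (A.map (Int.cast : ℤ → ℝ)).mulVec v i = 0) : v = 0 := by
  have near : ∀ w : Fin n → ℝ, (∀ i, (A.map (Int.cast : ℤ → ℝ)).mulVec y i = b i →
      (A.map (Int.cast : ℤ → ℝ)).mulVec w i = 0) →
      ∀ᶠ ε in nhds (0 : ℝ), y + ε • w ∈ polyOf A b := by
    intro w hw
    simp only [mem_polyOf_iff, Matrix.mulVec_add, Matrix.mulVec_smul, Pi.add_apply,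
      Pi.smul_apply, smul_eq_mul]
    refine Filter.eventually_all.2 fun i => ?_
    rcases (mem_polyOf_iff.1 hy.1 i).eq_or_lt with h | h
    · simp [hw i h, h]
    · have hcont : Continuous fun ε : ℝ => (A.map (Int.cast : ℤ → ℝ)).mulVec y i +
          ε * (A.map (Int.cast : ℤ → ℝ)).mulVec w i := by fun_prop
      exact (hcont.continuousAt.eventually_lt_const (by simpa using h)).mono fun _ => le_of_lt
  have h1 := near v hv
  have h2 := near (-v) fun i hi => by simp [Matrix.mulVec_neg, hv i hi]
  obtain ⟨ε, ⟨h3, h4⟩, h5⟩ := (((h1.and h2).filter_mono nhdsWithin_le_nhds).and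
    (self_mem_nhdsWithin (s := Set.Ioi (0 : ℝ)))).exists
  have h6 := hy.2 h3 h4 ⟨1 / 2, 1 / 2, by norm_num, by norm_num, by norm_num, by
    ext i; simp; ring⟩
  have h7 : ε • v = 0 := by simpa using h6
  exact (smul_eq_zero.1 h7).resolve_left (ne_of_gt h5)

/-- The extreme points of `polyOf A b` with a prescribed set of tight constraints are given by
a formula that is linear in `b`, with integral coefficients and a common denominator. -/
theorem exists_extremePoints_formula {κ : Type*} [Fintype κ] {n : ℕ}
    (A : Matrix κ (Fin n) ℤ) (I : Set κ) :
    ∃ (M : Matrix (Fin n) κ ℤ) (d : ℤ), 0 < d ∧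
      ∀ b : κ → ℤ, ∀ y ∈ (polyOf A b).extremePoints ℝ,
        {i | (A.map (Int.cast : ℤ → ℝ)).mulVec y i = b i} = I →
        ∀ j, (d : ℝ) * y j = ((M.mulVec b j : ℤ) : ℝ) := by
  classical
  let B : Matrix κ (Fin n) ℤ := Matrix.of fun i j => if i ∈ I then A i j else 0
  let BR : Matrix κ (Fin n) ℝ := B.map (Int.cast : ℤ → ℝ)
  let G : Matrix (Fin n) (Fin n) ℤ := B.transpose * B
  have hBR : ∀ (v : Fin n → ℝ) i, BR.mulVec v i =
      if i ∈ I then (A.map (Int.cast : ℤ → ℝ)).mulVec v i else 0 := by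
    intro v i
    by_cases hi : i ∈ I <;> simp [BR, B, Matrix.mulVec, dotProduct, hi]
  have hGR : G.map (Int.cast : ℤ → ℝ) = BR.transpose * BR := by
    simp only [G, BR]
    rw [← Matrix.transpose_map]
    exact Matrix.map_mul (f := Int.castRingHom ℝ)
  by_cases hG : G.det = 0
  · refine ⟨0, 1, one_pos, fun b y hy hI => ?_⟩
    exfalso
    have hdet : (BR.transpose * BR).det = 0 := by
      rw [← hGR]
      have := (Int.castRingHom ℝ).map_det G
      rw [hG, map_zero] at this
      exact this.symm
    obtain ⟨v, hv0, hv⟩ := Matrix.exists_mulVec_eq_zero_iff.2 hdet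
    have hv' : BR.mulVec v = 0 := by
      have h : BR.mulVec v ⬝ᵥ BR.mulVec v = 0 := by
        rw [Matrix.dotProduct_mulVec, Matrix.vecMul_mulVec, ← Matrix.dotProduct_mulVec, hv,
          dotProduct_zero]
      exact dotProduct_self_eq_zero.1 h
    refine hv0 (eq_zero_of_mulVec_tight_eq_zero hy fun i hi => ?_)
    have hiI : i ∈ I := hI ▸ hi
    simpa [hBR, hiI] using congrFun hv' i
  · refine ⟨G.det • (G.adjugate * B.transpose), G.det * G.det, mul_self_pos.2 hG,
      fun b y hy hI j => ?_⟩
    have h1 : (B.transpose.map (Int.cast : ℤ → ℝ)).mulVec (fun i => (b i : ℝ)) =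
        (G.map (Int.cast : ℤ → ℝ)).mulVec y := by
      rw [hGR, ← Matrix.mulVec_mulVec]
      ext j
      simp only [Matrix.mulVec, dotProduct]
      refine Finset.sum_congr rfl fun i _ => ?_
      by_cases hi : i ∈ I
      · have h2 : (A.map (Int.cast : ℤ → ℝ)).mulVec y i = b i := by
          rw [← hI] at hi; exact hi
        have h3 := hBR y i
        rw [if_pos hi, h2] at h3
        simp only [Matrix.mulVec, dotProduct] at h3
        rw [h3]; rfl
      · simp [B, BR, hi]
    have h2 : (fun j => (((G.adjugate * B.transpose).mulVec b j : ℤ) : ℝ)) =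
        (G.det : ℝ) • y := by
      have h3 : (fun j => (((G.adjugate * B.transpose).mulVec b j : ℤ) : ℝ)) =
          ((G.adjugate.map (Int.cast : ℤ → ℝ)).mulVec
            ((B.transpose.map (Int.cast : ℤ → ℝ)).mulVec (fun i => (b i : ℝ)))) := by
        ext j
        rw [← Matrix.mulVec_mulVec]
        simp [Matrix.mulVec, dotProduct]
      have h4 : G.adjugate.map (Int.cast : ℤ → ℝ) * G.map (Int.cast : ℤ → ℝ) =
          (G.det : ℝ) • (1 : Matrix (Fin n) (Fin n) ℝ) := by
        have := congrArg (fun X : Matrix (Fin n) (Fin n) ℤ => X.map (Int.castRingHom ℝ))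
          (Matrix.adjugate_mul G)
        simp only [Matrix.map_mul] at this
        refine Eq.trans this ?_
        ext i j
        by_cases hij : i = j <;>
          simp only [Matrix.map_apply, Matrix.smul_apply, Matrix.one_apply, hij, if_true, if_false,
            smul_eq_mul, mul_one, mul_zero, eq_intCast, Int.cast_zero]
      rw [h3, h1, Matrix.mulVec_mulVec, h4, Matrix.smul_mulVec, Matrix.one_mulVec]
    have h3 := congrFun h2 j
    simp only [Pi.smul_apply, smul_eq_mul] at h3
    rw [Matrix.smul_mulVec, Pi.smul_apply, smul_eq_mul]
    rw [Int.cast_mul, Int.cast_mul, h3, mul_assoc]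

/-- **Gordan's lemma**: the integral points of a rational polyhedral cone form a finitely
generated monoid. -/
theorem exists_finset_generating_nonneg {ι κ : Type*} [Finite ι] [Finite κ]
    (f : ι → (κ → ℤ) →+ ℤ) :
    ∃ T : Finset (κ → ℤ), (∀ v ∈ T, ∀ i, 0 ≤ f i v) ∧
      ∀ u, (∀ i, 0 ≤ f i u) → ∃ a : (κ → ℤ) → ℕ, u = ∑ v ∈ T, a v • v := by
  classical
  let castHom (α : Type _) : (α → ℕ) →+ (α → ℤ) :=
    { toFun := fun p i => p i, map_zero' := by ext; simp, map_add' := by intros; ext; simp }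
  let pos : (κ → ℕ) × (κ → ℕ) × (ι → ℕ) →+ (κ → ℤ) :=
    (castHom κ).comp (AddMonoidHom.fst _ _)
  let neg : (κ → ℕ) × (κ → ℕ) × (ι → ℕ) →+ (κ → ℤ) :=
    (castHom κ).comp ((AddMonoidHom.fst _ _).comp (AddMonoidHom.snd _ _))
  let slack : (κ → ℕ) × (κ → ℕ) × (ι → ℕ) →+ (ι → ℤ) :=
    { toFun := fun x i => x.2.2 i, map_zero' := by ext; simp, map_add' := by intros; ext; simp }
  obtain ⟨T, hT⟩ := (AddSubmonoid.fg_eqLocusM ((AddMonoidHom.pi f).comp (pos - neg)) slack).map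
    (pos - neg)
  have hmem : ∀ u, u ∈ AddSubmonoid.closure (T : Set (κ → ℤ)) ↔ ∀ i, 0 ≤ f i u := by
    intro u
    rw [hT, AddSubmonoid.mem_map]
    constructor
    · rintro ⟨x, hx, rfl⟩ i
      have h : f i ((pos - neg) x) = x.2.2 i := congrFun hx i
      rw [h]
      exact Int.natCast_nonneg _
    · intro hu
      have hx : (pos - neg) (fun j => (u j).toNat, fun j => (-u j).toNat,
          fun i => (f i u).toNat) = u := by
        ext j
        exact Int.toNat_sub_toNat_neg (u j)
      refine ⟨_, ?_, hx⟩
      change AddMonoidHom.pi f ((pos - neg) _) = _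
      rw [hx]
      ext i
      exact (Int.toNat_of_nonneg (hu i)).symm
  refine ⟨T, fun v hv => (hmem v).1 (AddSubmonoid.subset_closure hv), fun u hu => ?_⟩
  obtain ⟨a, ha⟩ := AddSubmonoid.mem_closure_finset'.1 ((hmem u).2 hu)
  refine ⟨fun v => if hv : v ∈ T then a ⟨v, hv⟩ else 0, ?_⟩
  rw [ha, ← Finset.sum_coe_sort T]
  simp

/-- The point with coordinates `(M b) j / d`, as an additive function of `b`. -/
noncomputable def candidateVertex {κ : Type*} [Fintype κ] {n : ℕ} (M : Matrix (Fin n) κ ℤ)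
    (d : ℤ) : (κ → ℤ) →+ (Fin n → ℝ) :=
  AddMonoidHom.mk' (fun b j => ((M.mulVec b j : ℤ) : ℝ) / d) fun a b => by
    ext j
    simp [Matrix.mulVec_add, add_div]

theorem candidateVertex_mem_polyOf_iff {κ : Type*} [Fintype κ] {n : ℕ}
    {A : Matrix κ (Fin n) ℤ} {M : Matrix (Fin n) κ ℤ} {d : ℤ} (hd : 0 < d) {b : κ → ℤ} :
    candidateVertex M d b ∈ polyOf A b ↔ ∀ i, 0 ≤ d * b i - A.mulVec (M.mulVec b) i := by
  have hd' : (0 : ℝ) < d := Int.cast_pos.2 hd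
  refine forall_congr' fun i => ?_
  have h : ∑ j, (A i j : ℝ) * candidateVertex M d b j =
      ((A.mulVec (M.mulVec b) i : ℤ) : ℝ) / d := by
    simp only [candidateVertex, AddMonoidHom.mk'_apply]
    rw [Matrix.mulVec, dotProduct, Int.cast_sum, Finset.sum_div]
    exact Finset.sum_congr rfl fun j _ => by push_cast; ring
  rw [h, div_le_iff₀ hd', sub_nonneg, mul_comm d, ← Int.cast_mul, Int.cast_le]

/-- Finitely many additive functions of the right-hand side suffice to describe the vertices of
all the polytopes with constraint matrix `A`. -/
theorem exists_candidateVertex_convex_combination {κ : Type*} [Fintype κ] {n : ℕ}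
    (A : Matrix κ (Fin n) ℤ) :
    ∃ (M : Set κ → Matrix (Fin n) κ ℤ) (d : Set κ → ℤ), (∀ I, 0 < d I) ∧
      ∀ b : κ → ℤ, IsCompact (polyOf A b) → ∀ y ∈ polyOf A b,
        ∃ (τ : Type) (_ : Fintype τ) (w : τ → ℝ) (I : τ → Set κ),
          (∀ t, 0 ≤ w t) ∧ ∑ t, w t = 1 ∧
          (∀ t, candidateVertex (M (I t)) (d (I t)) b ∈ polyOf A b) ∧
          y = ∑ t, w t • candidateVertex (M (I t)) (d (I t)) b := by
  choose M d hd hMd using exists_extremePoints_formula A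
  refine ⟨M, d, hd, fun b hb y hy => ?_⟩
  let V : Set (Fin n → ℝ) :=
    Set.range (fun I => candidateVertex (M I) (d I) b) ∩ polyOf A b
  have hV : V.Finite := (Set.finite_range _).inter_of_left _
  have hext : (polyOf A b).extremePoints ℝ ⊆ V := by
    intro x hx
    refine ⟨⟨{i | (A.map (Int.cast : ℤ → ℝ)).mulVec x i = b i}, ?_⟩, hx.1⟩
    ext j
    have hd0 := (Int.cast_pos (R := ℝ)).2 (hd {i | (A.map (Int.cast : ℤ → ℝ)).mulVec x i = b i})
    exact (eq_div_of_mul_eq hd0.ne' (by rw [mul_comm]; exact hMd _ b x hx rfl j)).symm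
  have hyV : y ∈ convexHull ℝ V := by
    rw [← closure_convexHull_extremePoints hb (convex_polyOf A b)] at hy
    exact closure_minimal (convexHull_mono hext) (hV.isClosed_convexHull ℝ) hy
  obtain ⟨τ, _, w, x, hw0, hw1, hx, rfl⟩ := mem_convexHull_iff_exists_fintype.1 hyV
  choose I hI using fun t => (hx t).1
  refine ⟨τ, inferInstance, w, I, hw0, hw1, fun t => ?_, ?_⟩
  · have := (hx t).2
    rwa [← hI t] at this
  · exact Finset.sum_congr rfl fun t _ => by rw [← hI t]

theorem Reduces.trans {ι : Type*} {u v w : ι → ℝ} (huv : Reduces u v) (hvw : Reduces v w) :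
    Reduces u w := by
  intro i
  obtain ⟨h1, h2⟩ := huv i
  obtain ⟨h3, h4⟩ := hvw i
  refine ⟨?_, h2.trans h4⟩
  by_cases hv : v i = 0
  · have hu : u i = 0 := by simpa [hv] using h2
    simp [hu]
  · refine nonneg_of_mul_nonneg_left (b := v i * v i) ?_ (mul_self_pos.2 hv)
    calc 0 ≤ (u i * v i) * (v i * w i) := mul_nonneg h1 h3
      _ = _ := by ring

theorem mem_trunc_of_reduces {ι : Type*} {C S S' : Set (ι → ℝ)} {x y : ι → ℝ}
    (hy : y ∈ trunc C S) (hxy : Reduces x y) (hx : x ∈ S') : x ∈ trunc C S' :=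
  ⟨hx, fun ⟨c, hc, hcx⟩ => hy.2 ⟨c, hc, hcx.trans hxy⟩⟩

theorem nsmul_mem_minkSMul {α : Type*} [AddMonoid α] {S : Set α} {x : α} (m : ℕ)
    (hx : m ≠ 0 → x ∈ S) : m • x ∈ minkSMul m S := by
  induction m with
  | zero => simp [minkSMul]
  | succ m ih =>
    rw [succ_nsmul']
    exact Set.add_mem_add (hx m.succ_ne_zero) (ih fun _ => hx m.succ_ne_zero)

/-- A summand of a sum of vectors lying in a common orthant reduces the sum. -/
theorem reduces_sum_nsmul {ι κ : Type*} [Fintype κ] (s : ι → ℤˣ) (lam : κ → ℕ)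
    (x : κ → ι → ℝ) (hx : ∀ j, lam j ≠ 0 → ∀ i, 0 ≤ ((s i : ℤ) : ℝ) * x j i) {j : κ}
    (hj : lam j ≠ 0) : Reduces (x j) (∑ j, lam j • x j) := by
  intro i
  have hterm : ∀ j, 0 ≤ ((s i : ℤ) : ℝ) * (lam j • x j) i := by
    intro j
    by_cases h : lam j = 0
    · simp [h]
    · rw [Pi.smul_apply, nsmul_eq_mul, mul_left_comm]
      exact mul_nonneg (Nat.cast_nonneg _) (hx j h i)
  have h1 : ((s i : ℤ) : ℝ) * x j i ≤ ((s i : ℤ) : ℝ) * (∑ j, lam j • x j) i := by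
    calc ((s i : ℤ) : ℝ) * x j i ≤ lam j * (((s i : ℤ) : ℝ) * x j i) :=
          le_mul_of_one_le_left (hx j hj i) (by exact_mod_cast Nat.one_le_iff_ne_zero.2 hj)
      _ = ((s i : ℤ) : ℝ) * (lam j • x j) i := by
          rw [Pi.smul_apply, nsmul_eq_mul, mul_left_comm]
      _ ≤ ∑ j, ((s i : ℤ) : ℝ) * (lam j • x j) i :=
          Finset.single_le_sum (fun j _ => hterm j) (Finset.mem_univ j)
      _ = _ := by rw [Finset.sum_apply, Finset.mul_sum]
  have h0 := hx j hj i
  generalize (∑ j, lam j • x j) i = a at h1 ⊢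
  rcases Int.units_eq_one_or (s i) with h | h <;> rw [h] at h0 h1 <;>
    simp only [Units.val_one, Units.val_neg, Int.cast_one, Int.cast_neg, one_mul,
      neg_mul] at h0 h1
  · exact ⟨mul_nonneg h0 (h0.trans h1), abs_le_abs_of_nonneg h0 h1⟩
  · have h2 : x j i ≤ 0 := by linarith
    exact ⟨mul_nonneg_of_nonpos_of_nonpos h2 (by linarith), abs_le_abs_of_nonpos h2 (by linarith)⟩

/-- The constraint matrix `W` together with the constraints defining the orthant with
sign vector `s`. -/
def orthantMatrix {m n : ℕ} (W : Matrix (Fin m) (Fin n) ℤ) (s : Fin n → ℤˣ) :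
    Matrix (Fin m ⊕ Fin n) (Fin n) ℤ :=
  Matrix.of (Sum.elim W fun i j => if i = j then -(s i : ℤ) else 0)

/-- A right-hand side for `W`, extended by zeros to one for `orthantMatrix W s`. -/
def extendZero (m n : ℕ) : (Fin m → ℤ) →+ (Fin m ⊕ Fin n → ℤ) :=
  AddMonoidHom.mk' (fun u => Sum.elim u 0) fun a b => by
    ext (i | i) <;> simp

theorem mem_polyOf_orthantMatrix_iff {m n : ℕ} {W : Matrix (Fin m) (Fin n) ℤ}
    {s : Fin n → ℤˣ} {u : Fin m → ℤ} {y : Fin n → ℝ} :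
    y ∈ polyOf (orthantMatrix W s) (extendZero m n u) ↔
      y ∈ polyOf W u ∧ ∀ i, 0 ≤ ((s i : ℤ) : ℝ) * y i := by
  refine Sum.forall.trans (and_congr Iff.rfl (forall_congr' fun i => ?_))
  have h : ∀ j, orthantMatrix W s (Sum.inr i) j = if i = j then -(s i : ℤ) else 0 := fun _ => rfl
  have h' : extendZero m n u (Sum.inr i) = 0 := rfl
  simp [h, h']

theorem exists_sign_mul_nonneg {ι : Type*} (y : ι → ℝ) :
    ∃ s : ι → ℤˣ, ∀ i, 0 ≤ ((s i : ℤ) : ℝ) * y i := by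
  have h : ∀ i, ∃ e : ℤˣ, 0 ≤ ((e : ℤ) : ℝ) * y i := by
    intro i
    rcases le_total 0 (y i) with h | h
    · exact ⟨1, by simpa using h⟩
    · exact ⟨-1, by simpa using h⟩
  exact ⟨fun i => (h i).choose, fun i => (h i).choose_spec⟩

/-- If the rows of `W ∈ ℤ^{m×n}` positively span `ℝ^n` and `𝒞 ⊆ ℝ^n` is any set of
vectors, then the family of truncated polytopes `tr_𝒞(P_z)`, `z ∈ 𝒰(W) ∩ ℤ^m`, has a
finite generating set. -/
theorem finite_generating_set_of_truncated_polytopes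
    {m n : ℕ} (W : Matrix (Fin m) (Fin n) ℤ)
    (hpos : ∀ x : Fin n → ℝ, ∃ μ : Fin m → ℝ, (∀ i, 0 ≤ μ i) ∧
      x = ∑ i, μ i • (fun j => (W i j : ℝ)))
    (C : Set (Fin n → ℝ)) :
    ∃ (k : ℕ) (h : Fin k → (Fin m → ℤ)),
      (∀ j, (polyOf W (h j)).Nonempty) ∧
      ∀ z : Fin m → ℤ, (polyOf W z).Nonempty →
        ∃ lam : Fin k → ℕ,
          z = ∑ j, lam j • h j ∧
          trunc C (polyOf W z) ⊆ ∑ j, minkSMul (lam j) (trunc C (polyOf W (h j))) := by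
  classical
  choose M d hd hcomb using fun s => exists_candidateVertex_convex_combination (orthantMatrix W s)
  let vert (p : (Fin n → ℤˣ) × Set (Fin m ⊕ Fin n)) : (Fin m → ℤ) →+ (Fin n → ℝ) :=
    (candidateVertex (M p.1 p.2) (d p.1 p.2)).comp (extendZero m n)
  let Q (s : Fin n → ℤˣ) (u : Fin m → ℤ) : Set (Fin n → ℝ) :=
    polyOf (orthantMatrix W s) (extendZero m n u)
  have hQc : ∀ s u, IsCompact (Q s u) := fun s u =>
    (isCompact_polyOf W hpos u).of_isClosed_subset (isClosed_polyOf _ _)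
      fun y hy => (mem_polyOf_orthantMatrix_iff.1 hy).1
  let feas (z : Fin m → ℤ) : Set ((Fin n → ℤˣ) × Set (Fin m ⊕ Fin n)) :=
    {p | vert p z ∈ Q p.1 z}
  have hgen : ∀ F : Set ((Fin n → ℤˣ) × Set (Fin m ⊕ Fin n)), ∃ T : Finset (Fin m → ℤ),
      (∀ v ∈ T, F ⊆ feas v) ∧
      ∀ u, F ⊆ feas u → ∃ a : (Fin m → ℤ) → ℕ, u = ∑ v ∈ T, a v • v := by
    intro F
    obtain ⟨T, hT, hT'⟩ := exists_finset_generating_nonneg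
      (fun q : F × (Fin m ⊕ Fin n) => AddMonoidHom.mk'
        (fun u : Fin m → ℤ => d q.1.1.1 q.1.1.2 * extendZero m n u q.2 -
          (orthantMatrix W q.1.1.1).mulVec ((M q.1.1.1 q.1.1.2).mulVec (extendZero m n u)) q.2)
        fun a b => by
          simp only [map_add, Matrix.mulVec_add, Pi.add_apply]
          ring)
    have key : ∀ u, F ⊆ feas u ↔ ∀ q : F × (Fin m ⊕ Fin n),
        0 ≤ d q.1.1.1 q.1.1.2 * extendZero m n u q.2 -
          (orthantMatrix W q.1.1.1).mulVec
            ((M q.1.1.1 q.1.1.2).mulVec (extendZero m n u)) q.2 := fun u =>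
      ⟨fun h q => (candidateVertex_mem_polyOf_iff (hd _ _)).1 (h q.1.2) q.2,
        fun h p hp => (candidateVertex_mem_polyOf_iff (hd _ _)).2 fun i => h (⟨p, hp⟩, i)⟩
    exact ⟨T, fun v hv => (key v).2 (hT v hv), fun u hu => hT' u ((key u).1 hu)⟩
  choose T hT hT' using hgen
  have : Fintype (Set ((Fin n → ℤˣ) × Set (Fin m ⊕ Fin n))) := Fintype.ofFinite _
  let H : Finset (Fin m → ℤ) :=
    (Finset.univ.biUnion T).filter fun v => (polyOf W v).Nonempty
  refine ⟨H.card, fun j => (H.equivFin.symm j).1,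
    fun j => (Finset.mem_filter.1 (H.equivFin.symm j).2).2, fun z hz => ?_⟩
  have hfeas : (feas z).Nonempty := by
    obtain ⟨y, hy⟩ := hz
    obtain ⟨s, hs⟩ := exists_sign_mul_nonneg y
    obtain ⟨τ, _, w, I, -, hw1, hI, -⟩ := hcomb s _ (hQc s z) y
      (mem_polyOf_orthantMatrix_iff.2 ⟨hy, hs⟩)
    obtain ⟨t⟩ : Nonempty τ := by
      by_contra hτ
      rw [not_nonempty_iff] at hτ
      simp at hw1
    exact ⟨(s, I t), hI t⟩
  have hTH : T (feas z) ⊆ H := by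
    intro v hv
    obtain ⟨p, hp⟩ := hfeas
    exact Finset.mem_filter.2 ⟨Finset.mem_biUnion.2 ⟨_, Finset.mem_univ _, hv⟩, _,
      (mem_polyOf_orthantMatrix_iff.1 (hT _ v hv hp)).1⟩
  obtain ⟨a, ha⟩ := hT' (feas z) z subset_rfl
  let lam (j : Fin H.card) : ℕ :=
    if (H.equivFin.symm j).1 ∈ T (feas z) then a (H.equivFin.symm j).1 else 0
  have hz_sum : z = ∑ j, lam j • (H.equivFin.symm j).1 := by
    rw [Equiv.sum_comp H.equivFin.symm
      (fun v : H => (if v.1 ∈ T (feas z) then a v.1 else 0) • v.1),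
      Finset.sum_coe_sort H (fun v => (if v ∈ T (feas z) then a v else 0) • v)]
    simp only [ite_smul, zero_smul]
    rw [Finset.sum_ite_mem, Finset.inter_eq_right.2 hTH]
    exact ha
  have hlam : ∀ j, lam j ≠ 0 → feas z ⊆ feas (H.equivFin.symm j).1 := by
    intro j hj
    exact hT _ _ (by by_contra h; exact hj (if_neg h))
  refine ⟨lam, hz_sum, fun y hy => ?_⟩
  obtain ⟨s, hs⟩ := exists_sign_mul_nonneg y
  obtain ⟨τ, _, w, I, hw0, hw1, hI, hyI⟩ := hcomb s _ (hQc s z) y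
    (mem_polyOf_orthantMatrix_iff.2 ⟨hy.1, hs⟩)
  let x (j : Fin H.card) : Fin n → ℝ := ∑ t, w t • vert (s, I t) (H.equivFin.symm j).1
  have hx : ∀ j, lam j ≠ 0 → x j ∈ Q s (H.equivFin.symm j).1 := fun j hj =>
    (convex_polyOf _ _).sum_mem (fun t _ => hw0 t) hw1
      fun t _ => hlam j hj (a := (s, I t)) (hI t)
  have hyx : ∑ j, lam j • x j = y := by
    have hv : ∀ t, vert (s, I t) z = ∑ j, lam j • vert (s, I t) (H.equivFin.symm j).1 := by
      intro t
      conv_lhs => rw [hz_sum]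
      simp only [map_sum, map_nsmul]
    calc ∑ j, lam j • x j
        = ∑ t, w t • ∑ j, lam j • vert (s, I t) (H.equivFin.symm j).1 := by
          simp only [x, Finset.smul_sum]
          rw [Finset.sum_comm]
          exact Finset.sum_congr rfl fun t _ => Finset.sum_congr rfl fun j _ =>
            smul_comm _ _ _
      _ = ∑ t, w t • vert (s, I t) z := by simp only [hv]
      _ = y := hyI.symm
  refine (Set.mem_finsetSum _ _ _).2 ⟨fun j => lam j • x j, fun {j} _ => ?_, hyx⟩
  refine nsmul_mem_minkSMul _ fun hj => mem_trunc_of_reduces hy ?_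
    (mem_polyOf_orthantMatrix_iff.1 (hx j hj)).1
  rw [← hyx]
  exact reduces_sum_nsmul s lam x (fun j hj => (mem_polyOf_orthantMatrix_iff.1 (hx j hj)).2) hj
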